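/- Let H be a Hadamard matrix of order n. Then the number Z(3,H) of vanishing minors of order 3 of H equals n²(n−1)(n−2)(n−4)(5n−4)/288. -/

import Mathlib

/-- A `{±1}`-matrix: every entry is `+1` or `-1`. -/
def IsPM1 {n : ℕ} (A : Matrix (Fin n) (Fin n) ℝ) : Prop :=
  ∀ i j, A i j = 1 ∨ A i j = -1

/-- A Hadamard matrix of order `n`. -/
def IsHadamardMatrix {n : ℕ} (H : Matrix (Fin n) (Fin n) ℝ) : Prop :=
  IsPM1 H ∧ H * H.transpose = (n : ℝ) • (1 : Matrix (Fin n) (Fin n) ℝ)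

/-- `Z m A` is the number of pairs `(R, C)` of `m`-element subsets of the row and
column indices of `A` such that the `m × m` submatrix of `A` on rows `R` and
columns `C` has vanishing determinant. -/
noncomputable def Z {n : ℕ} (m : ℕ) (A : Matrix (Fin n) (Fin n) ℝ) : ℕ :=
  Nat.card {p : Finset (Fin n) × Finset (Fin n) //
    ∃ (h₁ : p.1.card = m) (h₂ : p.2.card = m),
      (A.submatrix (fun i => (p.1.orderIsoOfFin h₁ i : Fin n))
        (fun j => (p.2.orderIsoOfFin h₂ j : Fin n))).det = 0}

theorem aux_det {A : Matrix (Fin 3) (Fin 3) ℝ} (h : ∀ i j, A i j = 1 ∨ A i j = -1) :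
    A.det ^ 2 = if A.det = 0 then 0 else 16 := by
  have key : A.det = 0 ∨ A.det = 4 ∨ A.det = -4 := by
    rw [Matrix.det_fin_three]
    have h1 : A 1 1 * A 2 2 - A 1 2 * A 2 1 = 0 ∨ A 1 1 * A 2 2 - A 1 2 * A 2 1 = 2 ∨
      A 1 1 * A 2 2 - A 1 2 * A 2 1 = -2 := by
      rcases h 1 1 with h11 | h11 <;> rcases h 1 2 with h12 | h12 <;>
      rcases h 2 1 with h21 | h21 <;> rcases h 2 2 with h22 | h22 <;>
      rw [h11, h12, h21, h22] <;> norm_num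
    rcases h 0 0 with h00 | h00 <;> rcases h 0 1 with h01 | h01 <;> rcases h 0 2 with h02 | h02 <;>
    rw [h00, h01, h02] <;>
    (rcases h 1 0 with h10 | h10 <;> rcases h 1 1 with h11 | h11 <;> rcases h 1 2 with h12 | h12 <;>
    rw [h10, h11, h12] <;>
    (rcases h 2 0 with h20 | h20 <;> rcases h 2 1 with h21 | h21 <;> rcases h 2 2 with h22 | h22 <;>
    rw [h20, h21, h22] <;> norm_num))
  rcases key with h | h | h <;> rw [h] <;> norm_num

theorem aux_sum {n : ℕ} (B : Matrix (Fin 3) (Fin n) ℝ)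
    (hB : ∀ i j, ∑ a, B i a * B j a = if i = j then (n : ℝ) else 0) :
    ∑ f : Fin 3 → Fin n, (B.submatrix id f).det ^ 2 = 6 * (n : ℝ) ^ 3 := by
  have h1 : ∀ f : Fin 3 → Fin n, (B.submatrix id f).det ^ 2 =
      ∑ σ : Equiv.Perm (Fin 3), ∑ τ : Equiv.Perm (Fin 3),
        (((Equiv.Perm.sign σ : ℤ) : ℝ) * ((Equiv.Perm.sign τ : ℤ) : ℝ)) *
          ∏ i, (B (σ i) (f i) * B (τ i) (f i)) := by
    intro f
    rw [sq, Matrix.det_apply', Finset.sum_mul_sum]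
    refine Finset.sum_congr rfl fun σ _ => Finset.sum_congr rfl fun τ _ => ?_
    rw [Finset.prod_mul_distrib]
    simp only [Matrix.submatrix_apply, id]
    ring
  simp_rw [h1]
  rw [Finset.sum_comm]
  have h2 : ∀ σ : Equiv.Perm (Fin 3), ∑ f : Fin 3 → Fin n, ∑ τ : Equiv.Perm (Fin 3),
        (((Equiv.Perm.sign σ : ℤ) : ℝ) * ((Equiv.Perm.sign τ : ℤ) : ℝ)) *
          ∏ i, (B (σ i) (f i) * B (τ i) (f i)) = (n : ℝ) ^ 3 := by
    intro σ
    rw [Finset.sum_comm]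
    have h3 : ∀ τ : Equiv.Perm (Fin 3), ∑ f : Fin 3 → Fin n,
        (((Equiv.Perm.sign σ : ℤ) : ℝ) * ((Equiv.Perm.sign τ : ℤ) : ℝ)) *
          ∏ i, (B (σ i) (f i) * B (τ i) (f i)) = if τ = σ then (n : ℝ) ^ 3 else 0 := by
      intro τ
      rw [← Finset.mul_sum]
      have h4 := Finset.prod_univ_sum (fun _ : Fin 3 => (Finset.univ : Finset (Fin n)))
        (fun i a => B (σ i) a * B (τ i) a)
      rw [Fintype.piFinset_univ] at h4
      rw [← h4]
      simp_rw [hB]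
      split_ifs with h
      · subst h
        simp only [if_true, Finset.prod_const, Finset.card_univ, Fintype.card_fin]
        rcases Int.units_eq_one_or (Equiv.Perm.sign τ) with h | h <;> rw [h] <;> simp
      · obtain ⟨i, hi⟩ : ∃ i, σ i ≠ τ i := by
          by_contra! hc
          exact h (Equiv.ext fun i => (hc i).symm)
        rw [Finset.prod_eq_zero (Finset.mem_univ i) (by simp [hi]), mul_zero]
    simp_rw [h3]
    simp
  simp_rw [h2]
  simp [Fintype.card_perm, Nat.factorial]

abbrev P3 (n : ℕ) := {s : Finset (Fin n) // s.card = 3}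

theorem aux_reindex {n : ℕ} (F : (Fin 3 → Fin n) → ℝ)
    (h0 : ∀ f, ¬ Function.Injective f → F f = 0)
    (hs : ∀ f (σ : Equiv.Perm (Fin 3)), F (f ∘ σ) = F f) :
    ∑ f, F f = 6 * ∑ C : P3 n, F (C.1.orderEmbOfFin C.2) := by
  have h1 : ∑ f, F f = ∑ x : P3 n × Equiv.Perm (Fin 3), F (x.1.1.orderEmbOfFin x.1.2 ∘ x.2) := by
    symm
    refine Finset.sum_of_injOn (fun x => x.1.1.orderEmbOfFin x.1.2 ∘ x.2) ?_ (by simp) ?_ (by simp)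
    · rintro ⟨⟨s, hs⟩, σ⟩ - ⟨⟨t, ht⟩, τ⟩ - h
      dsimp only at h
      have : s = t := by
        have h' := congrArg Set.range h
        rw [σ.surjective.range_comp, τ.surjective.range_comp, Finset.range_orderEmbOfFin,
          Finset.range_orderEmbOfFin] at h'
        exact_mod_cast h'
      subst this
      have : σ = τ := by
        ext i : 1
        exact (s.orderEmbOfFin hs).injective (congrFun h i)
      rw [this]
    · intro f _ hf
      apply h0
      intro hi
      apply hf
      have hc : (Finset.univ.image f).card = 3 := by
        rw [Finset.card_image_of_injective _ hi]; simp
      let g : Fin 3 → Fin 3 := fun i => ((Finset.univ.image f).orderIsoOfFin hc).symm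
        ⟨f i, Finset.mem_image_of_mem _ (Finset.mem_univ i)⟩
      have hg : Function.Injective g := by
        intro i j hij
        have := ((Finset.univ.image f).orderIsoOfFin hc).symm.injective hij
        exact hi (congrArg Subtype.val this)
      refine ⟨(⟨_, hc⟩, Equiv.ofBijective g (Finite.injective_iff_bijective.1 hg)), by simp, ?_⟩
      funext i
      simp [g, ← Finset.coe_orderIsoOfFin_apply]
  rw [h1, Fintype.sum_prod_type]
  simp_rw [hs]
  rw [Finset.mul_sum]
  refine Finset.sum_congr rfl fun C _ => ?_
  change ∑ _σ : Equiv.Perm (Fin 3), F (C.1.orderEmbOfFin C.2) = _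
  rw [Finset.sum_const, Finset.card_univ, Fintype.card_perm, nsmul_eq_mul]
  simp [Nat.factorial]

theorem count_vanishing_order_three_minors {n : ℕ}
    (H : Matrix (Fin n) (Fin n) ℝ) (hH : IsHadamardMatrix H) :
    288 * Z 3 H = n ^ 2 * (n - 1) * (n - 2) * (n - 4) * (5 * n - 4) := by
  classical
  obtain ⟨hpm, hh⟩ := hH
  let D : P3 n → P3 n → ℝ := fun R C =>
    (H.submatrix (R.1.orderEmbOfFin R.2) (C.1.orderEmbOfFin C.2)).det
  have hD : ∀ R, ∑ C, D R C ^ 2 = (n : ℝ) ^ 3 := by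
    intro R
    have a := aux_sum (H.submatrix (R.1.orderEmbOfFin R.2) id) (by
      intro i j
      have := congrFun (congrFun hh (R.1.orderEmbOfFin R.2 i)) (R.1.orderEmbOfFin R.2 j)
      simpa [Matrix.mul_apply, Matrix.one_apply] using this)
    rw [aux_reindex] at a
    · simp only [Matrix.submatrix_submatrix] at a
      simp only [D]
      have := mul_left_cancel₀ (by norm_num) a
      simpa using this
    · intro f hf
      simp only [Function.Injective, not_forall] at hf
      obtain ⟨i, j, hij, hne⟩ := hf
      rw [Matrix.det_zero_of_column_eq hne (by simp [hij])]
      simp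
    · intro f σ
      have := Matrix.det_permute' σ ((H.submatrix (R.1.orderEmbOfFin R.2) id).submatrix id f)
      rw [Matrix.submatrix_submatrix] at this
      change _ = _ at this
      rw [show (id ∘ id : Fin 3 → Fin 3) = id from rfl] at this
      rw [this, mul_pow]
      rcases Int.units_eq_one_or (Equiv.Perm.sign σ) with h | h <;> rw [h] <;> simp
  have hZ : Z 3 H = ∑ R, ∑ C, if D R C = 0 then 1 else 0 := by
    have e : {p : Finset (Fin n) × Finset (Fin n) //
      ∃ (h₁ : p.1.card = 3) (h₂ : p.2.card = 3),
      (H.submatrix (fun i => (p.1.orderIsoOfFin h₁ i : Fin n))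
        (fun j => (p.2.orderIsoOfFin h₂ j : Fin n))).det = 0} ≃
        {x : P3 n × P3 n // D x.1 x.2 = 0} :=
      { toFun := fun p => ⟨(⟨p.1.1, p.2.1⟩, ⟨p.1.2, p.2.2.1⟩), p.2.2.2⟩
        invFun := fun x => ⟨(x.1.1.1, x.1.2.1), x.1.1.2, x.1.2.2, x.2⟩
        left_inv := fun _ => rfl
        right_inv := fun _ => rfl }
    rw [Z, Nat.card_congr e, Nat.card_eq_fintype_card, Fintype.card_subtype,
      Finset.card_filter, Fintype.sum_prod_type]
  have hcard : Fintype.card (P3 n) = n.choose 3 := by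
    simp [P3]
  have hmain : 16 * (Z 3 H : ℝ) + n.choose 3 * (n : ℝ) ^ 3 = 16 * (n.choose 3 : ℝ) ^ 2 := by
    have h1 : ∀ R C, 16 * (if D R C = 0 then (1 : ℝ) else 0) + D R C ^ 2 = 16 := by
      intro R C
      have := aux_det (A := H.submatrix (R.1.orderEmbOfFin R.2) (C.1.orderEmbOfFin C.2))
        (fun i j => hpm _ _)
      simp only [D]
      rw [this]
      split_ifs <;> norm_num
    have h2 : ∑ R, ∑ C, (16 * (if D R C = 0 then (1 : ℝ) else 0) + D R C ^ 2)
        = 16 * (n.choose 3 : ℝ) ^ 2 := by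
      simp_rw [h1]
      simp only [Finset.sum_const, Finset.card_univ, hcard, nsmul_eq_mul]
      ring
    rw [← h2, hZ]
    simp only [Finset.sum_add_distrib, hD, ← Finset.mul_sum]
    simp only [Finset.sum_const, Finset.card_univ, hcard, nsmul_eq_mul]
    push_cast
    ring
  have hN : 16 * Z 3 H + n.choose 3 * n ^ 3 = 16 * (n.choose 3) ^ 2 := by exact_mod_cast hmain
  rcases Nat.lt_or_ge n 4 with h | h
  · interval_cases n <;> simp [Nat.choose] at hN ⊢ <;> omega
  · have hc : 6 * n.choose 3 = n * (n - 1) * (n - 2) := by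
      have := Nat.descFactorial_eq_factorial_mul_choose n 3
      simp [Nat.descFactorial, Nat.factorial] at this
      rw [← this]; ring
    obtain ⟨m, rfl⟩ := Nat.exists_eq_add_of_le h
    rw [show 4 + m - 1 = m + 3 by omega, show 4 + m - 2 = m + 2 by omega] at *
    rw [show 4 + m - 4 = m by omega, show 5 * (4 + m) - 4 = 5 * m + 16 by omega]
    generalize (4 + m).choose 3 = c at *
    zify at *
    have hc2 : (c : ℤ) ^ 2 * 36 = ((4 + m) * (m + 3) * (m + 2)) ^ 2 := by rw [← hc]; ring
    linear_combination 18 * hN + 8 * hc2 - 3 * (4 + m : ℤ) ^ 3 * hc
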